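/- For every real γ > 0, one has γ²·(K₁(γ)/K₂(γ))² + 3γ·(K₁(γ)/K₂(γ)) − γ² − 3 < 0. -/

import Mathlib

open MeasureTheory Real

/-- Modified Bessel function of the second kind of integer order `j`, via the integral
representation `K_j(γ) = (2^j j! / (2j)!) · γ^{-j} · ∫_γ^∞ e^{-λ} (λ² - γ²)^{j - 1/2} dλ`. -/
noncomputable def besselK (j : ℕ) (γ : ℝ) : ℝ :=
  ((2 : ℝ) ^ j * (Nat.factorial j) / (Nat.factorial (2 * j)) / γ ^ j) *
    ∫ l in Set.Ioi γ, Real.exp (-l) * (l ^ 2 - γ ^ 2) ^ ((j : ℝ) - 1 / 2)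

/-- The ratio `h_i(γ) = K_i(γ)/K_{i+1}(γ)`. -/
noncomputable def hRatio (i : ℕ) (γ : ℝ) : ℝ := besselK i γ / besselK (i + 1) γ

/-- The weight `e^{-l} (l² - γ²)^{-1/2}`. -/
noncomputable def besselWeight (γ l : ℝ) : ℝ := Real.exp (-l) * (l ^ 2 - γ ^ 2) ^ (-(1 / 2) : ℝ)

/-- The moments `∫_γ^∞ l^k e^{-l} (l² - γ²)^{-1/2} dl`. -/
noncomputable def besselMoment (γ : ℝ) (k : ℕ) : ℝ := ∫ l in Set.Ioi γ, l ^ k * besselWeight γ l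

lemma integrableOn_add_pow_mul_exp_neg_mul_rpow (γ : ℝ) (k : ℕ) :
    ∀ s : ℝ, 0 < s →
      IntegrableOn (fun u : ℝ => (u + γ) ^ k * (Real.exp (-u) * u ^ (s - 1))) (Set.Ioi 0) := by
  induction k with
  | zero => intro s hs; simpa using Real.GammaIntegral_convergent hs
  | succ k ih =>
    intro s hs
    refine ((ih (s + 1) (by linarith)).add ((ih s hs).const_mul γ)).congr_fun ?_ measurableSet_Ioi
    intro u hu
    have hu : (0 : ℝ) < u := hu
    have h : u ^ (s + 1 - 1) = u ^ (s - 1) * u := by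
      rw [← Real.rpow_add_one hu.ne']; ring_nf
    simp only [Pi.add_apply, h]
    ring

lemma integrableOn_pow_mul_besselWeight {γ : ℝ} (hγ : 0 < γ) (k : ℕ) :
    IntegrableOn (fun l => l ^ k * besselWeight γ l) (Set.Ioi γ) := by
  have h0 := integrableOn_add_pow_mul_exp_neg_mul_rpow γ k (1 / 2) (by norm_num)
  have h1 : IntegrableOn (fun l : ℝ => l ^ k * (Real.exp (-(l - γ)) * (l - γ) ^ ((1 / 2 : ℝ) - 1)))
      (Set.Ioi γ) := by
    rw [← integrable_indicator_iff measurableSet_Ioi] at h0 ⊢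
    refine (h0.comp_sub_right γ).congr (Filter.Eventually.of_forall fun l => ?_)
    simp [Set.indicator]
  refine (h1.const_mul (Real.exp (-γ) * γ ^ (-(1 / 2) : ℝ))).mono' ?_ ?_
  · unfold besselWeight
    fun_prop
  · refine (ae_restrict_iff' measurableSet_Ioi).2 (Filter.Eventually.of_forall fun l hl => ?_)
    have hl : γ < l := hl
    have hw : (l ^ 2 - γ ^ 2) ^ (-(1 / 2) : ℝ)
        = (l - γ) ^ (-(1 / 2) : ℝ) * (l + γ) ^ (-(1 / 2) : ℝ) := by
      rw [← Real.mul_rpow (by linarith) (by linarith)]; ring_nf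
    have hle : (l + γ) ^ (-(1 / 2) : ℝ) ≤ γ ^ (-(1 / 2) : ℝ) :=
      Real.rpow_le_rpow_of_nonpos hγ (by linarith) (by norm_num)
    have he : Real.exp (-l) = Real.exp (-γ) * Real.exp (-(l - γ)) := by
      rw [← Real.exp_add]; ring_nf
    have hl0 : 0 < l := hγ.trans hl
    have hd : 0 < l - γ := by linarith
    have hs : 0 < l + γ := by linarith
    unfold besselWeight
    rw [hw, he, Real.norm_of_nonneg (by positivity), show (1 / 2 : ℝ) - 1 = -(1 / 2) by norm_num]
    calc _ = (Real.exp (-γ) * l ^ k * Real.exp (-(l - γ)) * (l - γ) ^ (-(1 / 2) : ℝ))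
          * (l + γ) ^ (-(1 / 2) : ℝ) := by ring
      _ ≤ (Real.exp (-γ) * l ^ k * Real.exp (-(l - γ)) * (l - γ) ^ (-(1 / 2) : ℝ))
          * γ ^ (-(1 / 2) : ℝ) := by gcongr
      _ = _ := by ring

lemma rpow_nat_sub_half {x : ℝ} (hx : 0 < x) (j : ℕ) :
    x ^ ((j : ℝ) - 1 / 2) = x ^ j * x ^ (-(1 / 2) : ℝ) := by
  rw [sub_eq_add_neg, Real.rpow_add hx, Real.rpow_natCast]

lemma sq_sub_sq_pos_of_lt {γ l : ℝ} (hγ : 0 < γ) (hl : γ < l) : 0 < l ^ 2 - γ ^ 2 := by nlinarith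

/-- Integration by parts: the derivative of `l^k e^{-l} (l² - γ²)^{1/2}` integrates to zero. -/
lemma besselMoment_recurrence {γ : ℝ} (hγ : 0 < γ) (k : ℕ) :
    besselMoment γ (k + 2) - γ ^ 2 * besselMoment γ k
      = (k + 1) * besselMoment γ (k + 1) - k * γ ^ 2 * besselMoment γ (k - 1) := by
  have hi := integrableOn_pow_mul_besselWeight hγ
  set f : ℝ → ℝ := fun l => l ^ k * (Real.exp (-l) * (l ^ 2 - γ ^ 2) ^ (1 / 2 : ℝ))
  set f' : ℝ → ℝ := fun l =>
    ((k + 1) * (l ^ (k + 1) * besselWeight γ l) - k * γ ^ 2 * (l ^ (k - 1) * besselWeight γ l))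
      - (l ^ (k + 2) * besselWeight γ l - γ ^ 2 * (l ^ k * besselWeight γ l))
  have hpow : ∀ l : ℝ, (k : ℝ) * l ^ (k - 1) * l ^ 2 = k * l ^ (k + 1) := by
    intro l
    rcases k with _ | k
    · simp
    · simp only [Nat.add_sub_cancel]; ring
  have hhalf : ∀ l ∈ Set.Ioi γ, (l ^ 2 - γ ^ 2) ^ (1 / 2 : ℝ)
      = (l ^ 2 - γ ^ 2) * (l ^ 2 - γ ^ 2) ^ (-(1 / 2) : ℝ) := by
    intro l hl
    have h := rpow_nat_sub_half (sq_sub_sq_pos_of_lt hγ hl) 1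
    norm_num at h ⊢
    exact h
  have hderiv : ∀ l ∈ Set.Ioi γ, HasDerivAt f (f' l) l := by
    intro l hl
    have hp := sq_sub_sq_pos_of_lt hγ hl
    have h1 : HasDerivAt (fun l : ℝ => (l ^ 2 - γ ^ 2) ^ (1 / 2 : ℝ))
        (l * (l ^ 2 - γ ^ 2) ^ (-(1 / 2) : ℝ)) l := by
      have h := ((hasDerivAt_pow 2 l).sub_const (γ ^ 2)).rpow_const (p := 1 / 2) (Or.inl hp.ne')
      convert h using 1
      rw [show (1 / 2 : ℝ) - 1 = -(1 / 2) by norm_num]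
      push_cast
      ring
    have h2 : HasDerivAt (fun l : ℝ => Real.exp (-l)) (-Real.exp (-l)) l := by
      simpa using (hasDerivAt_neg l).exp
    refine ((hasDerivAt_pow k l).mul (h2.mul h1)).congr_deriv ?_
    simp only [f', besselWeight, Pi.mul_apply, hhalf l hl]
    linear_combination (Real.exp (-l) * (l ^ 2 - γ ^ 2) ^ (-(1 / 2) : ℝ)) * hpow l
  have hf'int : IntegrableOn f' (Set.Ioi γ) :=
    (((hi (k + 1)).const_mul _).sub ((hi (k - 1)).const_mul _)).sub
      ((hi (k + 2)).sub ((hi k).const_mul _))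
  have hfint : IntegrableOn f (Set.Ioi γ) := by
    refine ((hi (k + 2)).sub ((hi k).const_mul (γ ^ 2))).congr_fun ?_ measurableSet_Ioi
    intro l hl
    simp only [f, besselWeight, Pi.sub_apply, hhalf l hl]
    ring
  have hcont : ContinuousWithinAt f (Set.Ici γ) γ := by
    refine Continuous.continuousWithinAt ?_
    have : Continuous fun l : ℝ => (l ^ 2 - γ ^ 2) ^ (1 / 2 : ℝ) :=
      (by fun_prop : Continuous fun l : ℝ => l ^ 2 - γ ^ 2).rpow_const fun _ => Or.inr (by norm_num)
    fun_prop
  have key := integral_Ioi_of_hasDerivAt_of_tendsto hcont hderiv hf'int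
    (tendsto_zero_of_hasDerivAt_of_integrableOn_Ioi hderiv hf'int hfint)
  have hfγ : f γ = 0 := by simp [f]
  have hsplit : ∫ l in Set.Ioi γ, f' l
      = ((k + 1) * besselMoment γ (k + 1) - k * γ ^ 2 * besselMoment γ (k - 1))
        - (besselMoment γ (k + 2) - γ ^ 2 * besselMoment γ k) := by
    simp only [f', besselMoment]
    rw [integral_sub (((hi (k + 1)).const_mul _).sub' ((hi (k - 1)).const_mul _))
      ((hi (k + 2)).fun_sub ((hi k).const_mul _)),
      integral_sub ((hi (k + 1)).const_mul _) ((hi (k - 1)).const_mul _),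
      integral_sub (hi (k + 2)) ((hi k).const_mul _)]
    simp only [integral_const_mul]
  rw [hfγ, hsplit] at key
  linarith

lemma besselWeight_pos {γ l : ℝ} (hγ : 0 < γ) (hl : γ < l) : 0 < besselWeight γ l :=
  mul_pos (Real.exp_pos _) (Real.rpow_pos_of_pos (sq_sub_sq_pos_of_lt hγ hl) _)

lemma besselMoment_pos {γ : ℝ} (hγ : 0 < γ) (k : ℕ) : 0 < besselMoment γ k := by
  have hpos : ∀ l ∈ Set.Ioi γ, 0 < l ^ k * besselWeight γ l := fun l hl =>
    mul_pos (pow_pos (hγ.trans hl) k) (besselWeight_pos hγ hl)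
  refine (setIntegral_pos_iff_support_of_nonneg_ae
    ((ae_restrict_iff' measurableSet_Ioi).2 (Filter.Eventually.of_forall fun l hl => (hpos l hl).le))
    (integrableOn_pow_mul_besselWeight hγ k)).2 ?_
  have hsub : Set.Ioi γ ⊆ Function.support fun l => l ^ k * besselWeight γ l :=
    fun l hl => (hpos l hl).ne'
  rw [Set.inter_eq_right.2 hsub]
  simp

/-- The Cauchy–Schwarz inequality for the first three moments. -/
lemma besselMoment_one_sq_le {γ : ℝ} (hγ : 0 < γ) :
    besselMoment γ 1 ^ 2 ≤ besselMoment γ 0 * besselMoment γ 2 := by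
  have hi := integrableOn_pow_mul_besselWeight hγ
  have hB := besselMoment_pos hγ 0
  set A := besselMoment γ 1
  set B := besselMoment γ 0
  have h : 0 ≤ ∫ l in Set.Ioi γ, (B ^ 2 * (l ^ 2 * besselWeight γ l)
      - 2 * A * B * (l ^ 1 * besselWeight γ l)) + A ^ 2 * (l ^ 0 * besselWeight γ l) := by
    refine setIntegral_nonneg measurableSet_Ioi fun l hl => ?_
    have := mul_nonneg (sq_nonneg (B * l - A)) (besselWeight_pos hγ hl).le
    linarith
  rw [integral_add (((hi 2).const_mul _).sub' ((hi 1).const_mul _)) ((hi 0).const_mul _),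
    integral_sub ((hi 2).const_mul _) ((hi 1).const_mul _)] at h
  simp only [integral_const_mul] at h
  change 0 ≤ B ^ 2 * besselMoment γ 2 - 2 * A * B * A + A ^ 2 * B at h
  have h' : 0 ≤ B * (B * besselMoment γ 2 - A ^ 2) := by linarith
  linarith [nonneg_of_mul_nonneg_right h' hB]

lemma besselK_one_eq {γ : ℝ} (hγ : 0 < γ) : besselK 1 γ = besselMoment γ 1 / γ := by
  have hi := integrableOn_pow_mul_besselWeight hγ
  have h : ∫ l in Set.Ioi γ, Real.exp (-l) * (l ^ 2 - γ ^ 2) ^ (((1 : ℕ) : ℝ) - 1 / 2)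
      = besselMoment γ 2 - γ ^ 2 * besselMoment γ 0 := by
    simp only [besselMoment]
    rw [← integral_const_mul, ← integral_sub (hi 2) ((hi 0).const_mul _)]
    refine setIntegral_congr_fun measurableSet_Ioi fun l hl => ?_
    simp only [rpow_nat_sub_half (sq_sub_sq_pos_of_lt hγ hl), besselWeight]
    ring
  have h0 := besselMoment_recurrence hγ 0
  norm_num at h0
  rw [besselK, h, h0]
  norm_num [Nat.factorial]
  ring

lemma besselK_two_eq {γ : ℝ} (hγ : 0 < γ) :
    besselK 2 γ = (2 * besselMoment γ 1 + γ ^ 2 * besselMoment γ 0) / γ ^ 2 := by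
  have hi := integrableOn_pow_mul_besselWeight hγ
  have h : ∫ l in Set.Ioi γ, Real.exp (-l) * (l ^ 2 - γ ^ 2) ^ (((2 : ℕ) : ℝ) - 1 / 2)
      = besselMoment γ 4 - 2 * γ ^ 2 * besselMoment γ 2 + γ ^ 4 * besselMoment γ 0 := by
    simp only [besselMoment]
    rw [← integral_const_mul, ← integral_const_mul, ← integral_sub (hi 4) ((hi 2).const_mul _),
      ← integral_add ((hi 4).fun_sub ((hi 2).const_mul _)) ((hi 0).const_mul _)]
    refine setIntegral_congr_fun measurableSet_Ioi fun l hl => ?_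
    simp only [rpow_nat_sub_half (sq_sub_sq_pos_of_lt hγ hl), besselWeight]
    ring
  have h0 := besselMoment_recurrence hγ 0
  have h1 := besselMoment_recurrence hγ 1
  have h2 := besselMoment_recurrence hγ 2
  norm_num at h0 h1 h2
  have h3 : besselMoment γ 4 - 2 * γ ^ 2 * besselMoment γ 2 + γ ^ 4 * besselMoment γ 0
      = 3 * (2 * besselMoment γ 1 + γ ^ 2 * besselMoment γ 0) := by
    linear_combination h2 + (6 - γ ^ 2) * h0 + 3 * h1
  rw [besselK, h, h3]
  norm_num [Nat.factorial]
  ring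

/-- For every `γ > 0`, `γ²(K₁/K₂)² + 3γ(K₁/K₂) − γ² − 3 < 0`. -/
theorem bessel_ratio_ineq1 (γ : ℝ) (hγ : 0 < γ) :
    γ ^ 2 * (besselK 1 γ / besselK 2 γ) ^ 2 + 3 * γ * (besselK 1 γ / besselK 2 γ)
      - γ ^ 2 - 3 < 0 := by
  have hA := besselMoment_pos hγ 1
  have hB := besselMoment_pos hγ 0
  have hCS := besselMoment_one_sq_le hγ
  have h0 := besselMoment_recurrence hγ 0
  norm_num at h0
  rw [besselK_one_eq hγ, besselK_two_eq hγ]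
  set A := besselMoment γ 1
  set B := besselMoment γ 0
  rw [show besselMoment γ 2 = A + γ ^ 2 * B by linarith] at hCS
  have hD : 0 < 2 * A + γ ^ 2 * B := by positivity
  have hr : A / γ / ((2 * A + γ ^ 2 * B) / γ ^ 2) = γ * A / (2 * A + γ ^ 2 * B) := by
    field_simp
  have hkey : γ ^ 2 * (γ * A / (2 * A + γ ^ 2 * B)) ^ 2
      + 3 * γ * (γ * A / (2 * A + γ ^ 2 * B)) - γ ^ 2 - 3
      = -((γ ^ 2 + 3) * (2 * A + γ ^ 2 * B) ^ 2 - 3 * γ ^ 2 * A * (2 * A + γ ^ 2 * B)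
        - γ ^ 4 * A ^ 2) / (2 * A + γ ^ 2 * B) ^ 2 := by
    field_simp
    ring
  rw [hr, hkey]
  refine div_neg_of_neg_of_pos (neg_neg_of_pos ?_) (by positivity)
  have hrest : 0 < γ ^ 2 * A ^ 2 + 9 * γ ^ 2 * A * B + 12 * A ^ 2 := by positivity
  have hmain : 0 ≤ (γ ^ 4 + 3 * γ ^ 2) * (B * (A + γ ^ 2 * B) - A ^ 2) :=
    mul_nonneg (by positivity) (by linarith)
  linarith
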